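/- Given a sequence of colorings c_k : ω → (k+1) for k ≥ 1, define sets X_n as follows: partition ω into adjacent finite intervals B_1, B_2, ... with |B_k| = ⌈log₂(k+1)⌉, and if B_k = {n_0 < ... < n_{⌈log₂(k+1)⌉−1}}, let X_{n_j}(x) be the j-th binary digit (with leading zeros) of c_k(x). Then any infinite set Y that is cohesive for ⟨X_n⟩ is almost homogeneous for each c_k, i.e., for each k there is a finite set F such that Y − F is monochromatic for c_k. -/

import Mathlib

/-- Length of the `k`-th block: `⌈log₂ (k+1)⌉`. -/
def blockLen (k : ℕ) : ℕ := Nat.clog 2 (k + 1)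

/-- Starting position of the `k`-th block (blocks `B_1, B_2, …` are adjacent intervals,
`B_k` of length `⌈log₂(k+1)⌉`). -/
def blockStart (k : ℕ) : ℕ := ∑ m ∈ Finset.range k, blockLen m

/-- If the sets `X_n` code, on the `k`-th block of indices, the binary digits (with
leading zeros, most significant first) of `c_k(x)`, then any infinite set `Y` cohesive for
`⟨X_n⟩` is almost homogeneous for each `c_k`. -/
theorem stmt2 (c : ℕ → ℕ → ℕ) (hc : ∀ k, 1 ≤ k → ∀ x, c k x < k + 1)
    (X : ℕ → Set ℕ)
    (hX : ∀ k, 1 ≤ k → ∀ j < blockLen k,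
      X (blockStart k + j) = {x | Nat.testBit (c k x) (blockLen k - 1 - j)})
    (Y : Set ℕ) (hYinf : Y.Infinite)
    (hcoh : ∀ n, (Y ∩ X n).Finite ∨ (Y ∩ (X n)ᶜ).Finite) :
    ∀ k, 1 ≤ k → ∃ F : Finset ℕ, ∃ i, ∀ x ∈ Y, x ∉ F → c k x = i := by
  intro k hk
  have key : ∀ j, ∃ S : Set ℕ, S.Finite ∧ ∃ b : Bool, ∀ x ∈ Y, x ∉ S →
      Nat.testBit (c k x) j = b := by
    intro j
    by_cases hj : j < blockLen k
    · have h := hX k hk (blockLen k - 1 - j) (by omega)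
      have e : blockLen k - 1 - (blockLen k - 1 - j) = j := by omega
      rw [e] at h
      rcases hcoh (blockStart k + (blockLen k - 1 - j)) with hf | hf
      · refine ⟨_, hf, false, fun x hx hn => ?_⟩
        rw [h] at hn
        simpa [hx] using hn
      · refine ⟨_, hf, true, fun x hx hn => ?_⟩
        rw [h] at hn
        simpa [hx] using hn
    · refine ⟨∅, Set.finite_empty, false, fun x _ _ => ?_⟩
      apply Nat.testBit_lt_two_pow
      calc c k x < k + 1 := hc k hk x
        _ ≤ 2 ^ blockLen k := Nat.le_pow_clog (by norm_num) _
        _ ≤ 2 ^ j := Nat.pow_le_pow_right (by norm_num) (by omega)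
  choose S hS b hb using key
  have hfin : (⋃ j ∈ Finset.range (blockLen k), S j).Finite :=
    Set.Finite.biUnion (Finset.finite_toSet _) (fun j _ => hS j)
  obtain ⟨x₀, hx₀, hx₀n⟩ := (hYinf.diff hfin).nonempty
  refine ⟨hfin.toFinset, c k x₀, fun x hx hxn => ?_⟩
  rw [Set.Finite.mem_toFinset] at hxn
  have big : ∀ j, blockLen k ≤ j → ∀ y, Nat.testBit (c k y) j = false := by
    intro j hj y
    apply Nat.testBit_lt_two_pow
    calc c k y < k + 1 := hc k hk y
      _ ≤ 2 ^ blockLen k := Nat.le_pow_clog (by norm_num) _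
      _ ≤ 2 ^ j := Nat.pow_le_pow_right (by norm_num) hj
  apply Nat.eq_of_testBit_eq
  intro j
  by_cases hj : j < blockLen k
  · have hsub : ∀ y, y ∉ (⋃ j ∈ Finset.range (blockLen k), S j) → y ∉ S j := by
      intro y hy hyS
      exact hy (Set.mem_biUnion (Finset.mem_coe.2 (Finset.mem_range.2 hj)) hyS)
    rw [hb j x hx (hsub x hxn), hb j x₀ hx₀ (hsub x₀ hx₀n)]
  · rw [big j (by omega), big j (by omega)]
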